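/- arXiv:1704.08934 — 3 statements merged into one kernel-verified Lean document; each statement's English description precedes it below -/
import Mathlib

section
/- Let φ(x,y) be a prime p-encoding with input variables x_1,…,x_n, n ≥ 4. Then at least one of the following holds: (a) there is a p-encoding φ' with n input variables such that |φ| ≥ |φ'| + 1; (b) there is a p-encoding φ' with n−1 input variables such that |φ| ≥ |φ'| + 3; (c) φ is in regular form. Moreover, if φ is a 2-CNF formula, then in cases (a) and (b) the formula φ' can be taken to be a 2-CNF formula. -/
/-- A literal is a variable together with a polarity (`true` = positive). -/
abbrev Lit (V : Type) := V × Bool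

/-- The negation of a literal. -/
def negLit {V : Type} (l : Lit V) : Lit V := (l.1, !l.2)

/-- A clause is a finite set of literals. -/
abbrev Clause (V : Type) := Finset (Lit V)

/-- A CNF formula is a finite set of clauses. -/
abbrev CNF (V : Type) := Finset (Clause V)

/-- A clause proper contains no complementary pair of literals. -/
def IsClause {V : Type} [DecidableEq V] (C : Clause V) : Prop := ∀ l ∈ C, negLit l ∉ C

instance {V : Type} [DecidableEq V] (C : Clause V) : Decidable (IsClause C) := by
  unfold IsClause; infer_instance

/-- A CNF formula proper consists of proper clauses. -/
def IsCNF {V : Type} [DecidableEq V] (φ : CNF V) : Prop := ∀ C ∈ φ, IsClause C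

/-- Satisfaction of a literal by an assignment. -/
def LitSat {V : Type} (α : V → Bool) (l : Lit V) : Prop := α l.1 = l.2

/-- Satisfaction of a clause by an assignment. -/
def ClauseSat {V : Type} (α : V → Bool) (C : Clause V) : Prop := ∃ l ∈ C, LitSat α l

/-- Satisfaction of a CNF formula by an assignment. -/
def CnfSat {V : Type} (α : V → Bool) (φ : CNF V) : Prop := ∀ C ∈ φ, ClauseSat α C

/-- `UnitDerives φ C` : the clause `C` can be derived from `φ` by a series of unit
resolutions (each step resolves a derived unit clause with another derived clause). -/
inductive UnitDerives {V : Type} [DecidableEq V] (φ : CNF V) : Clause V → Prop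
  | base {C : Clause V} (h : C ∈ φ) : UnitDerives φ C
  | step {l : Lit V} {C : Clause V} (h1 : UnitDerives φ {l})
      (h2 : UnitDerives φ C) (h3 : negLit l ∈ C) :
      UnitDerives φ (C.erase (negLit l))

/-- The formula `φ ∧ l` (adding a unit clause). -/
def addUnit {V : Type} [DecidableEq V] (φ : CNF V) (l : Lit V) : CNF V :=
  insert {l} φ

/-- The formula `φ ∧ g₁ ∧ … ∧ g_p` (adding finitely many unit clauses). -/
def addUnits {V : Type} [DecidableEq V] (φ : CNF V) (L : Finset (Lit V)) : CNF V :=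
  φ ∪ L.image (fun l => ({l} : Clause V))

/-- Variables: `n` input variables and `ℓ` auxiliary variables. -/
abbrev Var (n ℓ : ℕ) : Type := Sum (Fin n) (Fin ℓ)

/-- The literal on the `i`-th input variable with polarity `b`. -/
def inLit {n ℓ : ℕ} (i : Fin n) (b : Bool) : Lit (Var n ℓ) := (Sum.inl i, b)

/-- A p-encoding: (P1) `φ ∧ x_i` is satisfiable for each input variable `x_i`, and
(P2) `φ ∧ x_i ⊢₁ ¬x_j` for all `i ≠ j`. -/
def IsPEncoding {n ℓ : ℕ} (φ : CNF (Var n ℓ)) : Prop :=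
  IsCNF φ ∧
  (∀ i : Fin n, ∃ α : Var n ℓ → Bool, CnfSat α φ ∧ α (Sum.inl i) = true) ∧
  (∀ i j : Fin n, i ≠ j →
    UnitDerives (addUnit φ (inLit i true)) {inLit j false})

/-- A p-encoding relative to a set `I` of input indices. -/
def IsPEncodingOn {n ℓ : ℕ} (φ : CNF (Var n ℓ)) (I : Finset (Fin n)) : Prop :=
  IsCNF φ ∧
  (∀ i ∈ I, ∃ α : Var n ℓ → Bool, CnfSat α φ ∧ α (Sum.inl i) = true) ∧
  (∀ i ∈ I, ∀ j ∈ I, i ≠ j →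
    UnitDerives (addUnit φ (inLit i true)) {inLit j false})

/-- 2-CNF: every clause has at most two literals. -/
def Is2CNF {V : Type} (φ : CNF V) : Prop := ∀ C ∈ φ, C.card ≤ 2

/-- The set of possible sizes of p-encodings with `n` input variables. -/
def pencSizes (n : ℕ) : Set ℕ :=
  {k | ∃ ℓ : ℕ, ∃ φ : CNF (Var n ℓ), IsPEncoding φ ∧ φ.card = k}

/-- `S n` : the minimum size of a p-encoding with `n` input variables. -/
noncomputable def S (n : ℕ) : ℕ := sInf (pencSizes n)

/-- The set of possible sizes of 2-CNF p-encodings with `n` input variables. -/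
def penc2Sizes (n : ℕ) : Set ℕ :=
  {k | ∃ ℓ : ℕ, ∃ φ : CNF (Var n ℓ), IsPEncoding φ ∧ Is2CNF φ ∧ φ.card = k}

/-- `S₂ n` : the minimum size of a 2-CNF p-encoding with `n` input variables. -/
noncomputable def S2 (n : ℕ) : ℕ := sInf (penc2Sizes n)

/-- `φ(x,y)` is an encoding of the boolean function `f(x)`. -/
def Encodes {n ℓ : ℕ} (φ : CNF (Var n ℓ)) (f : (Fin n → Bool) → Prop) : Prop :=
  IsCNF φ ∧
  ∀ α : Fin n → Bool, f α ↔ ∃ β : Fin ℓ → Bool, CnfSat (Sum.elim α β) φ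

/-- Injection of literals on input variables into literals of the encoding. -/
def inLits {n ℓ : ℕ} (G : Finset (Lit (Fin n))) : Finset (Lit (Var n ℓ)) :=
  G.image (fun g => ((Sum.inl g.1 : Var n ℓ), g.2))

/-- Propagation complete encoding of `f`: an encoding such that whenever
`f ∧ g₁ ∧ … ∧ g_p ⊨ h` for literals on input variables (`p ≥ 1`), unit propagation
from `φ ∧ g₁ ∧ … ∧ g_p` derives `h` or derives the empty clause. -/
def IsPCEncoding {n ℓ : ℕ} (φ : CNF (Var n ℓ)) (f : (Fin n → Bool) → Prop) : Prop :=
  Encodes φ f ∧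
  ∀ G : Finset (Lit (Fin n)), G.Nonempty → ∀ h : Lit (Fin n),
    (∀ α : Fin n → Bool, f α → (∀ g ∈ G, α g.1 = g.2) → α h.1 = h.2) →
    (UnitDerives (addUnits φ (inLits G)) {((Sum.inl h.1 : Var n ℓ), h.2)} ∨
     UnitDerives (addUnits φ (inLits G)) (∅ : Clause (Var n ℓ)))

/-- The "at most one" function. -/
def AMO (n : ℕ) (α : Fin n → Bool) : Prop :=
  (Finset.univ.filter fun i => α i = true).card ≤ 1

/-- The "exactly one" function. -/
def EXO (n : ℕ) (α : Fin n → Bool) : Prop :=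
  (Finset.univ.filter fun i => α i = true).card = 1

/-- `Qset φ i` : the set of clauses of `φ` containing the literal `¬x_i`. -/
def Qset {n ℓ : ℕ} (φ : CNF (Var n ℓ)) (i : Fin n) : CNF (Var n ℓ) :=
  φ.filter (fun C => inLit i false ∈ C)

/-- Regular form: for each `i`, `|Q_i| = 2`, clauses of `Q_i` contain no input variables
other than `x_i`, and all clauses of `Q_i` are binary. -/
def RegularForm {n ℓ : ℕ} (φ : CNF (Var n ℓ)) : Prop :=
  ∀ i : Fin n,
    (Qset φ i).card = 2 ∧
    (∀ C ∈ Qset φ i, ∀ j : Fin n, ∀ b : Bool, ((Sum.inl j : Var n ℓ), b) ∈ C → j = i) ∧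
    (∀ C ∈ Qset φ i, C.card = 2)

/-- `C` is an implicate of `φ`. -/
def Implicate {V : Type} (φ : CNF V) (C : Clause V) : Prop :=
  ∀ α : V → Bool, CnfSat α φ → ClauseSat α C

/-- `C` is a prime implicate of `φ`. -/
def PrimeImplicate {V : Type} (φ : CNF V) (C : Clause V) : Prop :=
  Implicate φ C ∧ ∀ C' : Clause V, C' ⊂ C → ¬ Implicate φ C'

/-- `φ` is prime: every clause of `φ` is a prime implicate of `φ`. -/
def IsPrime {V : Type} (φ : CNF V) : Prop := ∀ C ∈ φ, PrimeImplicate φ C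

/-- The set of clauses of `φ` in which the auxiliary variable `y` occurs
(as a positive or negative literal). -/
def occursIn {n ℓ : ℕ} (φ : CNF (Var n ℓ)) (y : Fin ℓ) : CNF (Var n ℓ) :=
  φ.filter (fun C => ((Sum.inr y : Var n ℓ), true) ∈ C ∨ ((Sum.inr y : Var n ℓ), false) ∈ C)

/-- The substitution `g₁ ← g₂` on a literal: `g₁ ↦ g₂`, `¬g₁ ↦ ¬g₂`,
all other literals unchanged. -/
def substLit {V : Type} [DecidableEq V] (g₁ g₂ : Lit V) (l : Lit V) : Lit V :=
  if l.1 = g₁.1 then (if l.2 = g₁.2 then g₂ else negLit g₂) else l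

/-- The substitution `g₁ ← g₂` applied to a clause. -/
def substClause {V : Type} [DecidableEq V] (g₁ g₂ : Lit V) (C : Clause V) : Clause V :=
  C.image (substLit g₁ g₂)

/-- The formula `φ[g₁ ← g₂]`: apply the substitution to every clause and remove the
clauses that became tautological (i.e. contain a complementary pair of literals). -/
def substCNF {V : Type} [DecidableEq V] (g₁ g₂ : Lit V) (φ : CNF V) : CNF V :=
  (φ.image (substClause g₁ g₂)).filter (fun C => IsClause C)

/-- `restrict φ ρ` : the formula `φ(ρ)` obtained from `φ` by the partial assignment
given by the set of literals `ρ` (clauses satisfied by `ρ` are removed, and falsified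
literals are removed from the remaining clauses). -/
def restrict {V : Type} [DecidableEq V] (φ : CNF V) (ρ : Finset (Lit V)) : CNF V :=
  (φ.filter (fun C => ∀ l ∈ ρ, l ∉ C)).image (fun C => C.filter (fun l => negLit l ∉ ρ))

section Literals

variable {V W : Type}

@[simp] theorem negLit_negLit (l : Lit V) : negLit (negLit l) = l := by
  simp [negLit]

theorem negLit_ne (l : Lit V) : negLit l ≠ l := by
  intro h
  have := congrArg Prod.snd h
  simp [negLit] at this

@[simp] theorem litSat_negLit (α : V → Bool) (l : Lit V) :
    LitSat α (negLit l) ↔ ¬ LitSat α l := by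
  simp only [LitSat, negLit]
  cases α l.1 <;> cases l.2 <;> simp

theorem not_clauseSat_empty (α : V → Bool) : ¬ ClauseSat α ∅ := by
  simp [ClauseSat]

@[simp] theorem clauseSat_singleton (α : V → Bool) (l : Lit V) :
    ClauseSat α {l} ↔ LitSat α l := by
  simp [ClauseSat]

theorem ClauseSat.mono {α : V → Bool} {C D : Clause V} (h : ClauseSat α C) (hCD : C ⊆ D) :
    ClauseSat α D :=
  let ⟨l, hl, hs⟩ := h
  ⟨l, hCD hl, hs⟩

theorem IsClause.subset [DecidableEq V] {C D : Clause V} (hD : IsClause D) (h : C ⊆ D) :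
    IsClause C :=
  fun l hl hn => hD l (h hl) (h hn)

theorem ClauseSat.erase [DecidableEq V] {α : V → Bool} {C : Clause V} {l : Lit V}
    (h : ClauseSat α C) (hl : ¬ LitSat α l) : ClauseSat α (C.erase l) := by
  obtain ⟨a, ha, hs⟩ := h
  exact ⟨a, Finset.mem_erase.2 ⟨fun e => hl (e ▸ hs), ha⟩, hs⟩

theorem cnfSat_addUnit [DecidableEq V] {α : V → Bool} {φ : CNF V} {l : Lit V} :
    CnfSat α (addUnit φ l) ↔ LitSat α l ∧ CnfSat α φ := by
  simp [CnfSat, addUnit]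

/-- Unit resolution is sound. -/
theorem UnitDerives.sound [DecidableEq V] {φ : CNF V} {C : Clause V} (h : UnitDerives φ C)
    {α : V → Bool} (hα : CnfSat α φ) : ClauseSat α C := by
  induction h with
  | base h => exact hα _ h
  | step _ _ _ ih₁ ih₂ => exact ih₂.erase (by simpa using ih₁)

/-- Simulation of unit resolution along a partial map of literals, given by its graph `R`.
The literals in `K` are those set to true by the transformation. -/
theorem UnitDerives.simulate [DecidableEq V] [DecidableEq W] {ψ : CNF V} {ψ' : CNF W}
    (R : Lit V → Lit W → Prop) (K : Set (Lit V))
    (hneg : ∀ l e, R l e → R (negLit l) (negLit e))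
    (hfun : ∀ l e e', R l e → R l e' → e = e')
    (hK : ∀ l ∈ K, ∀ e, ¬ R l e) (hKneg : ∀ l ∈ K, negLit l ∉ K)
    (hsat : ∃ β, CnfSat β ψ')
    (hbase : ∀ C ∈ ψ, (∃ l ∈ C, l ∈ K) ∨
      (∃ l₁ ∈ C, ∃ l₂ ∈ C, ∃ e, R l₁ e ∧ R l₂ (negLit e)) ∨
      ∃ E ∈ ψ', ∀ e ∈ E, ∃ l ∈ C, R l e)
    {D : Clause V} (h : UnitDerives ψ D) :
    (∃ l ∈ D, l ∈ K) ∨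
      (∃ l₁ ∈ D, ∃ l₂ ∈ D, ∃ e, R l₁ e ∧ R l₂ (negLit e)) ∨
      ∃ E, UnitDerives ψ' E ∧ ∀ e ∈ E, ∃ l ∈ D, R l e := by
  induction h with
  | base h =>
    rcases hbase _ h with h | h | ⟨E, hE, h⟩
    · exact Or.inl h
    · exact Or.inr (Or.inl h)
    · exact Or.inr (Or.inr ⟨E, .base hE, h⟩)
  | @step u C h₁ h₂ hu ih₁ ih₂ =>
    have hnegR : ∀ e, R (negLit u) e → R u (negLit e) := fun e he => by
      simpa using hneg _ _ he
    rcases ih₁ with ⟨l, hl, hlK⟩ | ⟨l₁, hl₁, l₂, hl₂, e, he₁, he₂⟩ | ⟨E, hE, hER⟩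
    · obtain rfl := Finset.mem_singleton.1 hl
      have hne : ∀ a e, R a e → a ≠ negLit l := by
        rintro a e h rfl
        exact hK l hlK _ (hnegR e h)
      rcases ih₂ with ⟨k, hk, hkK⟩ | ⟨l₁, hl₁, l₂, hl₂, e, he₁, he₂⟩ | ⟨E, hE, hER⟩
      · exact Or.inl ⟨k, Finset.mem_erase.2
          ⟨fun h => hKneg l hlK (h ▸ hkK), hk⟩, hkK⟩
      · exact Or.inr (Or.inl ⟨l₁, Finset.mem_erase.2 ⟨hne _ _ he₁, hl₁⟩,
          l₂, Finset.mem_erase.2 ⟨hne _ _ he₂, hl₂⟩, e, he₁, he₂⟩)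
      · refine Or.inr (Or.inr ⟨E, hE, fun e he => ?_⟩)
        obtain ⟨a, ha, hR⟩ := hER e he
        exact ⟨a, Finset.mem_erase.2 ⟨hne _ _ hR, ha⟩, hR⟩
    · obtain rfl := Finset.mem_singleton.1 hl₁
      obtain rfl := Finset.mem_singleton.1 hl₂
      exact absurd (hfun _ _ _ he₂ he₁) (negLit_ne e)
    · simp only [Finset.mem_singleton, exists_eq_left] at hER
      obtain ⟨β, hβ⟩ := hsat
      obtain ⟨e, heE, -⟩ := hE.sound hβ
      have hue := hER e heE
      have hEe : E = {e} := Finset.eq_singleton_iff_unique_mem.2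
        ⟨heE, fun a ha => hfun _ _ _ (hER a ha) hue⟩
      subst hEe
      rcases ih₂ with ⟨k, hk, hkK⟩ | ⟨l₁, hl₁, l₂, hl₂, a, ha₁, ha₂⟩ | ⟨E, hE', hER'⟩
      · refine Or.inl ⟨k, Finset.mem_erase.2 ⟨?_, hk⟩, hkK⟩
        rintro rfl
        exact hK _ hkK _ (hneg _ _ hue)
      · by_cases h₁ : l₁ = negLit u
        · subst h₁
          obtain rfl := hfun _ _ _ hue (hnegR _ ha₁)
          refine Or.inr (Or.inr ⟨_, hE, fun b hb => ?_⟩)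
          obtain rfl := Finset.mem_singleton.1 hb
          refine ⟨l₂, Finset.mem_erase.2 ⟨?_, hl₂⟩, ha₂⟩
          rintro rfl
          exact negLit_ne a (hfun _ _ _ ha₂ ha₁)
        · by_cases h₂ : l₂ = negLit u
          · subst h₂
            obtain rfl := hfun _ _ _ hue (hnegR _ ha₂)
            refine Or.inr (Or.inr ⟨_, hE, fun b hb => ?_⟩)
            obtain rfl := Finset.mem_singleton.1 hb
            exact ⟨l₁, Finset.mem_erase.2 ⟨h₁, hl₁⟩, by simpa using ha₁⟩
          · exact Or.inr (Or.inl ⟨l₁, Finset.mem_erase.2 ⟨h₁, hl₁⟩,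
              l₂, Finset.mem_erase.2 ⟨h₂, hl₂⟩, a, ha₁, ha₂⟩)
      · have key : ∀ a ∈ E, a ≠ negLit e → ∃ l ∈ C.erase (negLit u), R l a := by
          intro a ha hae
          obtain ⟨l, hl, hR⟩ := hER' a ha
          refine ⟨l, Finset.mem_erase.2 ⟨?_, hl⟩, hR⟩
          rintro rfl
          exact hae (hfun _ _ _ hR (hneg _ _ hue))
        by_cases hm : negLit e ∈ E
        · exact Or.inr (Or.inr ⟨_, .step hE hE' hm, fun a ha =>
            key a (Finset.mem_of_mem_erase ha) (Finset.ne_of_mem_erase ha)⟩)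
        · exact Or.inr (Or.inr ⟨E, hE', fun a ha => key a ha fun h => hm (h ▸ ha)⟩)

/-- The simulation theorem for derivations of unit clauses whose literal is in the domain
of the map. -/
theorem UnitDerives.simulate_singleton [DecidableEq V] [DecidableEq W] {ψ : CNF V} {ψ' : CNF W}
    (R : Lit V → Lit W → Prop) (K : Set (Lit V))
    (hneg : ∀ l e, R l e → R (negLit l) (negLit e))
    (hfun : ∀ l e e', R l e → R l e' → e = e')
    (hK : ∀ l ∈ K, ∀ e, ¬ R l e) (hKneg : ∀ l ∈ K, negLit l ∉ K)
    (hsat : ∃ β, CnfSat β ψ')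
    (hbase : ∀ C ∈ ψ, (∃ l ∈ C, l ∈ K) ∨
      (∃ l₁ ∈ C, ∃ l₂ ∈ C, ∃ e, R l₁ e ∧ R l₂ (negLit e)) ∨
      ∃ E ∈ ψ', ∀ e ∈ E, ∃ l ∈ C, R l e)
    {l : Lit V} {e : Lit W} (h : UnitDerives ψ {l}) (hle : R l e) : UnitDerives ψ' {e} := by
  rcases h.simulate R K hneg hfun hK hKneg hsat hbase with
    ⟨k, hk, hkK⟩ | ⟨l₁, hl₁, l₂, hl₂, a, ha₁, ha₂⟩ | ⟨E, hE, hER⟩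
  · obtain rfl := Finset.mem_singleton.1 hk
    exact absurd hle (hK _ hkK e)
  · obtain rfl := Finset.mem_singleton.1 hl₁
    obtain rfl := Finset.mem_singleton.1 hl₂
    exact absurd (hfun _ _ _ ha₂ ha₁) (negLit_ne a)
  · simp only [Finset.mem_singleton, exists_eq_left] at hER
    obtain ⟨β, hβ⟩ := hsat
    obtain ⟨b, hb, -⟩ := hE.sound hβ
    have hEe : E = {e} := Finset.eq_singleton_iff_unique_mem.2
      ⟨hfun _ _ _ hle (hER b hb) ▸ hb, fun a ha => hfun _ _ _ (hER a ha) hle⟩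
    exact hEe ▸ hE

/-- Let `M` be a set of models of the prime formula `φ` containing all models of `φ ∧ p`, and
suppose that every clause of `φ` containing `¬p` either has at least three literals, or is
satisfied by `M` without the help of `¬p`. Then the long clauses are useless for unit
propagation from `p`: what it derives holds already in `M`. -/
theorem UnitDerives.holds_of_long_clauses [DecidableEq V] {φ : CNF V} (hprime : IsPrime φ)
    {p q : Lit V} (M : (V → Bool) → Prop) (hM : ∀ α, M α → CnfSat α φ)
    (hpM : ∀ α, CnfSat α φ → LitSat α p → M α)
    (hp : ∃ α, CnfSat α φ ∧ LitSat α p)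
    (hlong : ∀ C ∈ φ, negLit p ∈ C → (∀ α, M α → ClauseSat α (C.erase (negLit p))) ∨ 3 ≤ C.card)
    (h : UnitDerives (addUnit φ p) {q}) (hqp : q ≠ p) (hqn : q ≠ negLit p) :
    ∀ α, M α → LitSat α q := by
  obtain ⟨α₀, hα₀, hα₀p⟩ := hp
  have hMα₀ := hpM α₀ hα₀ hα₀p
  let Long : Clause V → Prop := fun D => ∃ C ∈ φ, negLit p ∈ C ∧ 3 ≤ C.card ∧ D ⊆ C ∧
    ∀ m ∈ C, m ∉ D → m ≠ negLit p → ∀ α, M α → ¬ LitSat α m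
  have hunit : ∀ u, ¬ Long {u} := by
    rintro u ⟨C, hC, hpC, hcard, hu, hm⟩
    obtain ⟨himp, hmin⟩ := hprime C hC
    refine hmin {negLit p, u} ?_ ?_
    · refine Finset.ssubset_iff_subset_ne.2 ⟨?_, ?_⟩
      · simp only [Finset.singleton_subset_iff] at hu
        simp [Finset.insert_subset_iff, hpC, hu]
      · rintro rfl
        have := Finset.card_le_two (a := negLit p) (b := u)
        omega
    · intro α hα
      by_cases hαp : LitSat α p
      · obtain ⟨m, hmC, hms⟩ := himp α hα
        by_cases hmu : m = u
        · exact ⟨u, by simp, hmu ▸ hms⟩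
        · refine absurd hms (hm m hmC (by simpa using hmu) ?_ α (hpM α hα hαp))
          rintro rfl
          simp [hαp] at hms
      · exact ⟨negLit p, by simp, by simpa using hαp⟩
  have inv : ∀ D, UnitDerives (addUnit φ p) D →
      D = {p} ∨ (∀ α, M α → ClauseSat α (D.erase (negLit p))) ∨ Long D := by
    intro D hD
    induction hD with
    | @base C hC =>
      rcases Finset.mem_insert.1 hC with rfl | hC
      · exact Or.inl rfl
      · by_cases hpC : negLit p ∈ C
        · rcases hlong C hC hpC with h | h
          · exact Or.inr (Or.inl h)
          · exact Or.inr (Or.inr ⟨C, hC, hpC, h, Finset.Subset.refl _, fun m h₁ h₂ => absurd h₁ h₂⟩)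
        · refine Or.inr (Or.inl fun α hα => ?_)
          rw [Finset.erase_eq_of_notMem hpC]
          exact hM α hα C hC
    | @step u D _ _ hu ih₁ ih₂ =>
      have hup : u = p ∨ ∀ α, M α → LitSat α u := by
        rcases ih₁ with h | h | h
        · exact Or.inl (by simpa using h)
        · refine Or.inr fun α hα => ?_
          obtain ⟨a, ha, hs⟩ := h α hα
          obtain rfl := Finset.mem_singleton.1 (Finset.mem_of_mem_erase ha)
          exact hs
        · exact absurd h (hunit u)
      rcases ih₂ with rfl | h | ⟨C, hC, hpC, hcard, hDC, hm⟩
      · exfalso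
        have hu := Finset.mem_singleton.1 hu
        rcases hup with rfl | hup
        · exact negLit_ne _ hu
        · have := hup α₀ hMα₀
          rw [← hu] at hα₀p
          simp [this] at hα₀p
      · refine Or.inr (Or.inl fun α hα => ?_)
        rcases hup with rfl | hup
        · simpa using h α hα
        · rw [Finset.erase_right_comm]
          exact (h α hα).erase (by simpa using hup α hα)
      · refine Or.inr (Or.inr ⟨C, hC, hpC, hcard, (Finset.erase_subset _ _).trans hDC, ?_⟩)
        intro m hmC hmD hmp α hα
        by_cases hmu : m = negLit u
        · subst hmu
          rcases hup with rfl | hup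
          · exact absurd rfl hmp
          · simpa using hup α hα
        · exact hm m hmC (fun h => hmD (Finset.mem_erase.2 ⟨hmu, h⟩)) hmp α hα
  intro α hα
  rcases inv _ h with h | h | h
  · exact absurd (by simpa using h) hqp
  · obtain ⟨a, ha, hs⟩ := h α hα
    obtain rfl := Finset.mem_singleton.1 (Finset.mem_of_mem_erase ha)
    exact hs
  · exact absurd h (hunit q)

theorem exists_primeImplicate_subset {φ : CNF V} {C : Clause V} (hC : Implicate φ C) :
    ∃ D ⊆ C, PrimeImplicate φ D := by
  obtain ⟨D, hDC, hD⟩ := exists_minimal_le_of_wellFoundedLT (Implicate φ) C hC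
  exact ⟨D, hDC, hD.prop, fun E hE hi => hE.not_ge (hD.le_of_le hi hE.le)⟩

@[simp] theorem substLit_negLit [DecidableEq V] (g₁ g₂ l : Lit V) :
    substLit g₁ g₂ (negLit l) = negLit (substLit g₁ g₂ l) := by
  unfold substLit
  by_cases h : l.1 = g₁.1
  · cases h₁ : l.2 <;> cases h₂ : g₁.2 <;> simp [negLit, h, h₁]
  · simp [negLit, h]

theorem litSat_substLit [DecidableEq V] {α : V → Bool} {g₁ g₂ : Lit V}
    (h : LitSat α g₁ ↔ LitSat α g₂) (l : Lit V) :
    LitSat α (substLit g₁ g₂ l) ↔ LitSat α l := by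
  by_cases h₁ : l = g₁
  · subst h₁
    simp [substLit, h]
  · by_cases h₂ : l = negLit g₁
    · subst h₂
      rw [substLit_negLit, litSat_negLit, litSat_negLit]
      simp [substLit, h]
    · have : l.1 ≠ g₁.1 := by
        intro e
        obtain ⟨v, b⟩ := l
        obtain ⟨w, c⟩ := g₁
        simp only at e
        subst e
        cases b <;> cases c <;> simp [negLit] at h₁ h₂
      simp [substLit, this]

theorem cnfSat_substCNF [DecidableEq V] {α : V → Bool} {g₁ g₂ : Lit V} {φ : CNF V}
    (h : LitSat α g₁ ↔ LitSat α g₂) (hα : CnfSat α φ) : CnfSat α (substCNF g₁ g₂ φ) := by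
  intro C hC
  obtain ⟨D, hD, rfl⟩ := Finset.mem_image.1 (Finset.mem_filter.1 hC).1
  obtain ⟨l, hl, hs⟩ := hα D hD
  exact ⟨_, Finset.mem_image_of_mem _ hl, (litSat_substLit h l).2 hs⟩

theorem card_substCNF_lt [DecidableEq V] {φ : CNF V} {C : Clause V} (hC : C ∈ φ) {g₁ g₂ : Lit V}
    (h : ¬ IsClause (substClause g₁ g₂ C)) : (substCNF g₁ g₂ φ).card + 1 ≤ φ.card := by
  have hsub : substCNF g₁ g₂ φ ⊆ (φ.erase C).image (substClause g₁ g₂) := by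
    intro D hD
    obtain ⟨hD, hcl⟩ := Finset.mem_filter.1 hD
    obtain ⟨E, hE, rfl⟩ := Finset.mem_image.1 hD
    refine Finset.mem_image_of_mem _ (Finset.mem_erase.2 ⟨?_, hE⟩)
    rintro rfl
    exact h hcl
  have h₁ := (Finset.card_le_card hsub).trans Finset.card_image_le
  have h₂ := Finset.card_erase_add_one hC
  omega

theorem Is2CNF.substCNF [DecidableEq V] {φ : CNF V} (h : Is2CNF φ) (g₁ g₂ : Lit V) :
    Is2CNF (substCNF g₁ g₂ φ) := by
  intro C hC
  obtain ⟨D, hD, rfl⟩ := Finset.mem_image.1 (Finset.mem_filter.1 hC).1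
  exact Finset.card_image_le.trans (h D hD)

end Literals

section PEncodings

variable {n ℓ : ℕ}

theorem negLit_inLit (i : Fin n) (b : Bool) : negLit (inLit i b : Lit (Var n ℓ)) = inLit i !b :=
  rfl

theorem inLit_inj {i j : Fin n} {b c : Bool} :
    (inLit i b : Lit (Var n ℓ)) = inLit j c ↔ i = j ∧ b = c := by
  simp [inLit]

theorem litSat_inLit {α : Var n ℓ → Bool} {i : Fin n} {b : Bool} :
    LitSat α (inLit i b) ↔ α (Sum.inl i) = b :=
  Iff.rfl

theorem IsPEncoding.eq_false {φ : CNF (Var n ℓ)} (h : IsPEncoding φ) {i j : Fin n} (hij : i ≠ j)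
    {α : Var n ℓ → Bool} (hα : CnfSat α φ) (hi : α (Sum.inl i) = true) :
    α (Sum.inl j) = false := by
  simpa [litSat_inLit] using (h.2.2 i j hij).sound (cnfSat_addUnit.2 ⟨hi, hα⟩)

/-- Every p-encoding can be made prime by shortening its clauses. -/
theorem IsPEncoding.exists_isPrime {φ : CNF (Var n ℓ)} (h : IsPEncoding φ) :
    ∃ φ' : CNF (Var n ℓ), IsPEncoding φ' ∧ IsPrime φ' ∧ φ'.card ≤ φ.card ∧
      (Is2CNF φ → Is2CNF φ') ∧ ∀ i, (Qset φ' i).card ≤ (Qset φ i).card := by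
  have hex : ∀ C : Clause (Var n ℓ), ∃ D ⊆ C, C ∈ φ → PrimeImplicate φ D := by
    intro C
    by_cases hC : C ∈ φ
    · obtain ⟨D, hDC, hD⟩ := exists_primeImplicate_subset (φ := φ) (C := C) fun α hα => hα C hC
      exact ⟨D, hDC, fun _ => hD⟩
    · exact ⟨C, subset_rfl, fun h => absurd h hC⟩
  choose f hf hfp using hex
  have hsat : ∀ α, CnfSat α (φ.image f) ↔ CnfSat α φ := by
    intro α
    constructor
    · intro hα C hC
      exact (hα _ (Finset.mem_image_of_mem f hC)).mono (hf C)
    · intro hα C hC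
      obtain ⟨D, hD, rfl⟩ := Finset.mem_image.1 hC
      exact (hfp D hD).1 α hα
  refine ⟨φ.image f, ⟨?_, ?_, ?_⟩, ?_, Finset.card_image_le, ?_, ?_⟩
  · intro C hC
    obtain ⟨D, hD, rfl⟩ := Finset.mem_image.1 hC
    exact (h.1 D hD).subset (hf D)
  · simpa only [hsat] using h.2.1
  · intro i j hij
    obtain ⟨α, hα, hi⟩ := h.2.1 i
    refine (h.2.2 i j hij).simulate_singleton (fun l e => l = e) ∅ (by simp) (by simp_all)
      (by simp) (by simp) ⟨α, cnfSat_addUnit.2 ⟨litSat_inLit.2 hi, (hsat α).2 hα⟩⟩ ?_ rfl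
    intro C hC
    refine Or.inr (Or.inr ?_)
    rcases Finset.mem_insert.1 hC with rfl | hC
    · exact ⟨_, Finset.mem_insert_self _ _, by simp⟩
    · exact ⟨f C, Finset.mem_insert_of_mem (Finset.mem_image_of_mem f hC),
        fun e he => ⟨e, hf C he, rfl⟩⟩
  · intro C hC
    obtain ⟨D, hD, rfl⟩ := Finset.mem_image.1 hC
    simpa only [PrimeImplicate, Implicate, hsat] using hfp D hD
  · intro h2 C hC
    obtain ⟨D, hD, rfl⟩ := Finset.mem_image.1 hC
    exact (Finset.card_le_card (hf D)).trans (h2 D hD)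
  · intro i
    have hsub : Qset (φ.image f) i ⊆ (Qset φ i).image f := by
      intro C hC
      obtain ⟨hC, hi⟩ := Finset.mem_filter.1 hC
      obtain ⟨D, hD, rfl⟩ := Finset.mem_image.1 hC
      exact Finset.mem_image_of_mem f (Finset.mem_filter.2 ⟨hD, hf D hi⟩)
    exact (Finset.card_le_card hsub).trans Finset.card_image_le

/-- Identifying an auxiliary literal with an input variable to which it is equivalent in all
models where some input is true. -/
theorem IsPEncoding.substCNF {φ : CNF (Var n ℓ)} (h : IsPEncoding φ) {i : Fin n} {y : Fin ℓ}
    {b : Bool} (hiff : ∀ α, CnfSat α φ → ∀ j, α (Sum.inl j) = true →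
      (LitSat α (Sum.inr y, b) ↔ LitSat α (inLit i true))) :
    IsPEncoding (substCNF (Sum.inr y, b) (inLit i true) φ) := by
  have hin : ∀ (j : Fin n) (c : Bool),
      substLit (Sum.inr y, b) (inLit i true : Lit (Var n ℓ)) (inLit j c) = inLit j c := by
    simp [substLit, inLit]
  have hsat : ∀ j, ∃ α, CnfSat α (_root_.substCNF (Sum.inr y, b) (inLit i true) φ) ∧
      α (Sum.inl j) = true := fun j => by
    obtain ⟨α, hα, hj⟩ := h.2.1 j
    exact ⟨α, cnfSat_substCNF (hiff α hα j hj) hα, hj⟩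
  refine ⟨fun C hC => (Finset.mem_filter.1 hC).2, hsat, fun j k hjk => ?_⟩
  obtain ⟨α, hα, hj⟩ := hsat j
  refine (h.2.2 j k hjk).simulate_singleton
    (fun l e => substLit (Sum.inr y, b) (inLit i true) l = e) ∅
    (fun l e h => by rw [substLit_negLit, h]) (fun l e e' h h' => h.symm.trans h')
    (by simp) (by simp) ⟨α, cnfSat_addUnit.2 ⟨litSat_inLit.2 hj, hα⟩⟩ ?_ (hin k false)
  intro C hC
  rcases Finset.mem_insert.1 hC with rfl | hC
  · exact Or.inr (Or.inr ⟨_, Finset.mem_insert_self _ _, by simp [hin]⟩)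
  · by_cases hcl : IsClause (substClause (Sum.inr y, b) (inLit i true) C)
    · refine Or.inr (Or.inr ⟨_, Finset.mem_insert_of_mem
        (Finset.mem_filter.2 ⟨Finset.mem_image_of_mem _ hC, hcl⟩), ?_⟩)
      intro e he
      exact Finset.mem_image.1 he
    · simp only [IsClause, not_forall, not_not] at hcl
      obtain ⟨e, he, hne⟩ := hcl
      obtain ⟨l₁, hl₁, he₁⟩ := Finset.mem_image.1 he
      obtain ⟨l₂, hl₂, he₂⟩ := Finset.mem_image.1 hne
      exact Or.inr (Or.inl ⟨l₁, hl₁, l₂, hl₂, e, he₁, he₂⟩)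

/-- In a prime p-encoding where at most one binary clause contains `¬x_i`, a clause can be saved
by identifying the other literal of this clause with `x_i`. -/
theorem IsPEncoding.exists_smaller {φ : CNF (Var n ℓ)} (h : IsPEncoding φ) (hprime : IsPrime φ)
    (hn : 3 ≤ n) (i : Fin n) (hQ : ((Qset φ i).filter fun C => C.card = 2).card ≤ 1) :
    ∃ φ' : CNF (Var n ℓ), IsPEncoding φ' ∧ φ'.card + 1 ≤ φ.card ∧ (Is2CNF φ → Is2CNF φ') := by
  obtain ⟨j₀, hj₀⟩ : ∃ j : Fin n, j ≠ i :=
    have : Nontrivial (Fin n) := Fin.nontrivial_iff_two_le.2 (by omega)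
    exists_ne i
  have htwo : ∀ C ∈ φ, (inLit i false : Lit (Var n ℓ)) ∈ C → 2 ≤ C.card := by
    intro C hC hi
    by_contra hlt
    obtain rfl := Finset.eq_of_subset_of_card_le (Finset.singleton_subset_iff.2 hi)
      (by rw [Finset.card_singleton]; omega)
    obtain ⟨α, hα, hαi⟩ := h.2.1 i
    simpa [litSat_inLit, hαi] using hα _ hC
  have hprop := fun (j : Fin n) (hj : j ≠ i) (M : (Var n ℓ → Bool) → Prop) hM hpM hlong =>
    UnitDerives.holds_of_long_clauses hprime M hM hpM
      (by simpa only [litSat_inLit] using h.2.1 i) hlong (h.2.2 i j hj.symm)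
      (by simp [inLit_inj]) (by simp [negLit_inLit, inLit_inj, hj])
  by_cases hex : ∃ C ∈ φ, inLit i false ∈ C ∧ C.card = 2
  swap
  · obtain ⟨α, hα, hαj⟩ := h.2.1 j₀
    have := hprop j₀ hj₀ (fun α => CnfSat α φ) (fun _ h => h) (fun _ h _ => h)
      (fun C hC hi => Or.inr (by
        have h₁ := htwo C hC hi
        have h₂ : C.card ≠ 2 := fun h => hex ⟨C, hC, hi, h⟩
        omega)) α hα
    simp [litSat_inLit, hαj] at this
  obtain ⟨C₀, hC₀, hi₀, hcard₀⟩ := hex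
  obtain ⟨l, hl⟩ : ∃ l, C₀.erase (inLit i false) = {l} :=
    Finset.card_eq_one.1 (by rw [Finset.card_erase_of_mem hi₀, hcard₀])
  have hlC₀ : l ∈ C₀ := Finset.mem_of_mem_erase (hl ▸ Finset.mem_singleton_self l)
  have hil : ∀ α, CnfSat α φ → α (Sum.inl i) = true → LitSat α l := by
    intro α hα hαi
    have := (hα C₀ hC₀).erase (l := inLit i false) (by simp [litSat_inLit, hαi])
    simpa [hl] using this
  have hlj : ∀ j, j ≠ i → ∀ α, CnfSat α φ → LitSat α l → α (Sum.inl j) = false := by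
    intro j hj α hα hαl
    refine hprop j hj (fun α => CnfSat α φ ∧ LitSat α l) (fun _ h => h.1)
      (fun α hα hαi => ⟨hα, hil α hα hαi⟩) (fun C hC hi => ?_) α ⟨hα, hαl⟩
    have h₁ := htwo C hC hi
    by_cases h₂ : C.card = 2
    · left
      obtain rfl := Finset.card_le_one.1 hQ C
        (Finset.mem_filter.2 ⟨Finset.mem_filter.2 ⟨hC, hi⟩, h₂⟩) C₀ (by simp [Qset, hC₀, hi₀, hcard₀])
      rintro α ⟨-, hαl⟩
      simpa [negLit_inLit, hl] using hαl
    · right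
      omega
  obtain ⟨k | y, b⟩ := l
  · exfalso
    by_cases hki : k = i
    · subst hki
      cases b
      · have : ((Sum.inl k, false) : Lit (Var n ℓ)) ∈ C₀.erase (inLit k false) := by simp [hl]
        exact Finset.ne_of_mem_erase this rfl
      · exact h.1 C₀ hC₀ _ hlC₀ hi₀
    · cases b
      · obtain ⟨j, hj⟩ := Finset.exists_mem_notMem_of_card_lt_card
          (s := {i, k}) (t := (Finset.univ : Finset (Fin n)))
          (Finset.card_le_two.trans_lt (by rw [Finset.card_univ, Fintype.card_fin]; omega))
        simp only [Finset.mem_univ, Finset.mem_insert, Finset.mem_singleton, not_or,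
          true_and] at hj
        obtain ⟨α, hα, hαj⟩ := h.2.1 j
        have := hlj j hj.1 α hα (h.eq_false hj.2 hα hαj)
        simp [hαj] at this
      · obtain ⟨α, hα, hαi⟩ := h.2.1 i
        have h₁ : α (Sum.inl k) = true := hil α hα hαi
        simp [h.eq_false (Ne.symm hki) hα hαi] at h₁
  · refine ⟨_root_.substCNF (Sum.inr y, b) (inLit i true) φ, h.substCNF ?_, card_substCNF_lt hC₀ ?_,
      fun h2 => h2.substCNF _ _⟩
    · intro α hα j hαj
      refine ⟨fun hαl => ?_, hil α hα⟩
      by_cases hji : j = i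
      · exact hji ▸ hαj
      · simp [hlj j hji α hα hαl] at hαj
    · intro hcl
      refine hcl (inLit i true) (Finset.mem_image.2 ⟨_, hlC₀, ?_⟩)
        (Finset.mem_image.2 ⟨_, hi₀, ?_⟩)
      · simp [substLit]
      · simp [substLit, inLit, negLit]

end PEncodings

section Restriction

variable {m ℓ : ℕ}

/-- The literals over the variables other than the input variable `i`, as literals over all
variables. -/
def liftLit (i : Fin (m + 1)) (l : Lit (Var m ℓ)) : Lit (Var (m + 1) ℓ) :=
  (Sum.map i.succAbove id l.1, l.2)

theorem liftLit_injective (i : Fin (m + 1)) :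
    Function.Injective (liftLit i : Lit (Var m ℓ) → Lit (Var (m + 1) ℓ)) := by
  rintro ⟨v, b⟩ ⟨w, c⟩ h
  simp only [liftLit, Prod.mk.injEq] at h
  have hinj := Function.Injective.sumMap (Fin.succAbove_right_injective (p := i))
    (Function.injective_id (α := Fin ℓ))
  exact Prod.ext (hinj h.1) h.2

theorem liftLit_inLit (i : Fin (m + 1)) (j : Fin m) (b : Bool) :
    liftLit i (inLit j b : Lit (Var m ℓ)) = inLit (i.succAbove j) b :=
  rfl

theorem liftLit_ne_inLit (i : Fin (m + 1)) (b : Bool) (l : Lit (Var m ℓ)) :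
    liftLit i l ≠ inLit i b := by
  obtain ⟨j | y, c⟩ := l <;> simp [liftLit, inLit, Fin.succAbove_ne]

theorem exists_liftLit_eq (i : Fin (m + 1)) {l : Lit (Var (m + 1) ℓ)} (hl : l.1 ≠ Sum.inl i) :
    ∃ e, liftLit i e = l := by
  obtain ⟨j | y, b⟩ := l
  · obtain ⟨k, rfl⟩ := Fin.exists_succAbove_eq (x := j) (y := i) (by simpa using hl)
    exact ⟨(Sum.inl k, b), rfl⟩
  · exact ⟨(Sum.inr y, b), rfl⟩

/-- The clause `C` without the literals on the input variable `i`. -/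
def dropClause (i : Fin (m + 1)) (C : Clause (Var (m + 1) ℓ)) : Clause (Var m ℓ) :=
  Finset.univ.filter fun l => liftLit i l ∈ C

/-- The formula `φ` with the input variable `i` set to false. -/
def dropCNF (i : Fin (m + 1)) (φ : CNF (Var (m + 1) ℓ)) : CNF (Var m ℓ) :=
  (φ.filter fun C => inLit i false ∉ C).image (dropClause i)

@[simp] theorem mem_dropClause {i : Fin (m + 1)} {C : Clause (Var (m + 1) ℓ)}
    {l : Lit (Var m ℓ)} : l ∈ dropClause i C ↔ liftLit i l ∈ C := by
  simp [dropClause]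

theorem card_dropCNF_add (i : Fin (m + 1)) (φ : CNF (Var (m + 1) ℓ)) :
    (dropCNF i φ).card + (Qset φ i).card ≤ φ.card := by
  have h₁ : (dropCNF i φ).card ≤ _ := Finset.card_image_le
  have h₂ := Finset.card_filter_add_card_filter_not (s := φ) fun C => inLit i false ∈ C
  simp only [Qset]
  omega

theorem Is2CNF.dropCNF {φ : CNF (Var (m + 1) ℓ)} (h : Is2CNF φ) (i : Fin (m + 1)) :
    Is2CNF (dropCNF i φ) := by
  intro C hC
  obtain ⟨D, hD, rfl⟩ := Finset.mem_image.1 hC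
  refine le_trans ?_ (h D (Finset.mem_filter.1 hD).1)
  exact Finset.card_le_card_of_injOn (liftLit i) (fun l hl => mem_dropClause.1 hl)
    (liftLit_injective i).injOn

theorem card_Qset_dropCNF_le (i : Fin (m + 1)) (φ : CNF (Var (m + 1) ℓ)) (j : Fin m) :
    (Qset (dropCNF i φ) j).card ≤
      ((Qset φ (i.succAbove j)).filter fun C => inLit i false ∉ C).card := by
  refine le_trans (Finset.card_le_card ?_) (Finset.card_image_le (f := dropClause i))
  intro C hC
  obtain ⟨hC, hj⟩ := Finset.mem_filter.1 hC
  obtain ⟨D, hD, rfl⟩ := Finset.mem_image.1 hC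
  obtain ⟨hD, hi⟩ := Finset.mem_filter.1 hD
  exact Finset.mem_image_of_mem _ (Finset.mem_filter.2
    ⟨Finset.mem_filter.2 ⟨hD, mem_dropClause.1 hj⟩, hi⟩)

theorem IsPEncoding.dropCNF {φ : CNF (Var (m + 1) ℓ)} (h : IsPEncoding φ) (i : Fin (m + 1)) :
    IsPEncoding (dropCNF i φ) := by
  have hsat : ∀ j : Fin m, ∃ β : Var m ℓ → Bool, CnfSat β (_root_.dropCNF i φ) ∧
      β (Sum.inl j) = true := by
    intro j
    obtain ⟨α, hα, hj⟩ := h.2.1 (i.succAbove j)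
    refine ⟨fun v => α (Sum.map i.succAbove id v), ?_, hj⟩
    intro C hC
    obtain ⟨D, hD, rfl⟩ := Finset.mem_image.1 hC
    obtain ⟨hD, hi⟩ := Finset.mem_filter.1 hD
    obtain ⟨l, hl, hs⟩ := hα D hD
    have hne : l.1 ≠ Sum.inl i := by
      intro he
      obtain ⟨v, b⟩ := l
      simp only at he
      subst he
      cases b
      · exact hi hl
      · have h₁ : α (Sum.inl i) = true := hs
        simp [h.eq_false (Fin.succAbove_ne i j) hα hj] at h₁
    obtain ⟨e, rfl⟩ := exists_liftLit_eq i hne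
    exact ⟨e, mem_dropClause.2 hl, hs⟩
  refine ⟨?_, hsat, fun j k hjk => ?_⟩
  · intro C hC l hl hn
    obtain ⟨D, hD, rfl⟩ := Finset.mem_image.1 hC
    exact h.1 D (Finset.mem_filter.1 hD).1 _ (mem_dropClause.1 hl) (mem_dropClause.1 hn)
  · obtain ⟨β, hβ, hj⟩ := hsat j
    refine (h.2.2 (i.succAbove j) (i.succAbove k) (by simpa using hjk)).simulate_singleton
      (fun l e => liftLit i e = l) {inLit i false} ?_
      (fun l e e' h h' => liftLit_injective i (h.trans h'.symm)) ?_ ?_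
      ⟨β, cnfSat_addUnit.2 ⟨litSat_inLit.2 hj, hβ⟩⟩ ?_ (liftLit_inLit i k false)
    · rintro _ e rfl
      rfl
    · rintro _ rfl e
      exact liftLit_ne_inLit i false e
    · rintro _ rfl
      simp [negLit_inLit, inLit_inj]
    · intro C hC
      rcases Finset.mem_insert.1 hC with rfl | hC
      · exact Or.inr (Or.inr ⟨_, Finset.mem_insert_self _ _, by simp [liftLit_inLit]⟩)
      · by_cases hi : inLit i false ∈ C
        · exact Or.inl ⟨_, hi, rfl⟩
        · refine Or.inr (Or.inr ⟨dropClause i C, Finset.mem_insert_of_mem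
            (Finset.mem_image_of_mem _ (Finset.mem_filter.2 ⟨hC, hi⟩)), fun e he => ?_⟩)
          exact ⟨_, mem_dropClause.1 he, rfl⟩

end Restriction

/-- Let φ be a prime p-encoding with n ≥ 4 input variables. Then
(a) there is a p-encoding φ' with n input variables with |φ| ≥ |φ'| + 1, or
(b) there is a p-encoding φ' with n−1 input variables with |φ| ≥ |φ'| + 3, or
(c) φ is in regular form; moreover, in cases (a) and (b), if φ is 2-CNF then φ' can
be taken 2-CNF. -/
theorem structure_general_CNF (n ℓ : ℕ) (hn : 4 ≤ n) (φ : CNF (Var n ℓ))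
    (hpe : IsPEncoding φ) (hprime : IsPrime φ) :
    (∃ ℓ' : ℕ, ∃ φ' : CNF (Var n ℓ'), IsPEncoding φ' ∧ φ'.card + 1 ≤ φ.card ∧
      (Is2CNF φ → Is2CNF φ')) ∨
    (∃ ℓ' : ℕ, ∃ φ' : CNF (Var (n - 1) ℓ'), IsPEncoding φ' ∧ φ'.card + 3 ≤ φ.card ∧
      (Is2CNF φ → Is2CNF φ')) ∨
    RegularForm φ := by
  obtain ⟨m, rfl⟩ : ∃ m, n = m + 1 := ⟨n - 1, by omega⟩
  by_cases hQ3 : ∃ i, 3 ≤ (Qset φ i).card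
  · obtain ⟨i, hi⟩ := hQ3
    have := card_dropCNF_add i φ
    exact Or.inr (Or.inl ⟨ℓ, dropCNF i φ, hpe.dropCNF i, by omega, fun h2 => h2.dropCNF i⟩)
  push Not at hQ3
  by_cases hQ1 : ∃ i, ((Qset φ i).filter fun C => C.card = 2).card ≤ 1
  · obtain ⟨i, hi⟩ := hQ1
    exact Or.inl ⟨ℓ, hpe.exists_smaller hprime (by omega) i hi⟩
  push Not at hQ1
  by_cases hshared : ∃ i j, i ≠ j ∧ ∃ C ∈ φ, inLit i false ∈ C ∧ inLit j false ∈ C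
  · obtain ⟨i, j, hij, C, hC, hiC, hjC⟩ := hshared
    obtain ⟨k, rfl⟩ := Fin.exists_succAbove_eq hij.symm
    have hQi : 2 ≤ (Qset φ i).card := (hQ1 i).trans_le (Finset.card_filter_le _ _)
    have hQk : (Qset (dropCNF i φ) k).card ≤ 1 := by
      have h₁ := card_Qset_dropCNF_le i φ k
      have h₂ : ((Qset φ (i.succAbove k)).filter fun C => inLit i false ∉ C).card <
          (Qset φ (i.succAbove k)).card := by
        refine Finset.card_lt_card (Finset.filter_ssubset.2 ⟨C, ?_, by simpa using hiC⟩)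
        exact Finset.mem_filter.2 ⟨hC, hjC⟩
      have h₃ := hQ3 (i.succAbove k)
      omega
    obtain ⟨φ₁, hpe₁, hprime₁, hcard₁, h2₁, hQ₁⟩ := (hpe.dropCNF i).exists_isPrime
    obtain ⟨φ₂, hpe₂, hcard₂, h2₂⟩ := hpe₁.exists_smaller hprime₁ (by omega) k
      ((Finset.card_filter_le _ _).trans ((hQ₁ k).trans hQk))
    have := card_dropCNF_add i φ
    exact Or.inr (Or.inl ⟨ℓ, φ₂, hpe₂, by omega, fun h2 => h2₂ (h2₁ (h2.dropCNF i))⟩)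
  push Not at hshared
  refine Or.inr (Or.inr fun i => ?_)
  have hle := Finset.card_filter_le (Qset φ i) fun C => C.card = 2
  have h3 := hQ3 i
  have h1 := hQ1 i
  refine ⟨by omega, fun C hC j b hj => ?_, Finset.filter_card_eq (by omega)⟩
  obtain ⟨hC, hi⟩ := Finset.mem_filter.1 hC
  by_contra hji
  cases b
  · exact hshared i j (Ne.symm hji) C hC hi hj
  · refine (hprime C hC).2 _ (Finset.erase_ssubset hj) fun α hα => ?_
    by_cases hαi : α (Sum.inl i) = true
    · exact (hα C hC).erase (by
        simpa [LitSat] using hpe.eq_false (Ne.symm hji) hα hαi)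
    · exact ⟨inLit i false, Finset.mem_erase.2 ⟨by simp [inLit], hi⟩, by
        simpa [litSat_inLit] using hαi⟩
end

section
/- Every p-encoding with n input variables is an encoding of AMO_n or an encoding of EXO_n (not necessarily propagation complete). -/
/-- Unit resolution is sound. -/
theorem UnitDerives.clauseSat {V : Type} [DecidableEq V] {φ : CNF V} {C : Clause V}
    (h : UnitDerives φ C) {α : V → Bool} (hα : CnfSat α φ) : ClauseSat α C := by
  induction h with
  | base h => exact hα _ h
  | @step l C _ _ _ ih₁ ih₂ =>
    obtain ⟨l₁, hl₁, hs₁⟩ := ih₁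
    obtain ⟨l₂, hl₂, hs₂⟩ := ih₂
    rw [Finset.mem_singleton] at hl₁
    subst hl₁
    refine ⟨l₂, Finset.mem_erase.2 ⟨?_, hl₂⟩, hs₂⟩
    rintro rfl
    simp [LitSat, negLit] at hs₁ hs₂
    simp [hs₁] at hs₂

/-- A model of a p-encoding sets at most one input variable to true. -/
theorem IsPEncoding.input_eq_false {n ℓ : ℕ} {φ : CNF (Var n ℓ)} (hpe : IsPEncoding φ)
    {α : Var n ℓ → Bool} (hα : CnfSat α φ) {i j : Fin n} (hij : i ≠ j)
    (hi : α (Sum.inl i) = true) : α (Sum.inl j) = false := by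
  have hsat : CnfSat α (addUnit φ (inLit i true)) := by
    intro C hC
    rcases Finset.mem_insert.1 hC with rfl | hC
    · exact ⟨_, Finset.mem_singleton_self _, hi⟩
    · exact hα C hC
  obtain ⟨l, hl, hs⟩ := (hpe.2.2 i j hij).clauseSat hsat
  rw [Finset.mem_singleton] at hl
  subst hl
  exact hs

theorem IsPEncoding.amo_of_cnfSat {n ℓ : ℕ} {φ : CNF (Var n ℓ)} (hpe : IsPEncoding φ)
    {α : Fin n → Bool} {β : Fin ℓ → Bool} (h : CnfSat (Sum.elim α β) φ) : AMO n α := by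
  refine Finset.card_le_one.2 fun i hi j hj => ?_
  by_contra hij
  have hi' : α i = true := (Finset.mem_filter.1 hi).2
  have hj' : α j = true := (Finset.mem_filter.1 hj).2
  have hj₀ : α j = false := hpe.input_eq_false h hij hi'
  exact Bool.noConfusion (hj'.symm.trans hj₀)

theorem IsPEncoding.exists_cnfSat_of_exo {n ℓ : ℕ} {φ : CNF (Var n ℓ)} (hpe : IsPEncoding φ)
    {α : Fin n → Bool} (h : EXO n α) : ∃ β : Fin ℓ → Bool, CnfSat (Sum.elim α β) φ := by
  obtain ⟨i, hi⟩ := Finset.card_eq_one.1 h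
  have hα (j : Fin n) : α j = true ↔ j = i := by
    simpa using Finset.ext_iff.1 hi j
  obtain ⟨γ, hγ, hγi⟩ := hpe.2.1 i
  refine ⟨γ ∘ Sum.inr, ?_⟩
  have hαγ : α = γ ∘ Sum.inl := by
    funext j
    by_cases hj : j = i
    · subst hj
      exact ((hα j).2 rfl).trans hγi.symm
    · exact (Bool.eq_false_iff.2 (mt (hα j).1 hj)).trans
        (hpe.input_eq_false hγ (Ne.symm hj) hγi).symm
  rw [hαγ, Sum.elim_comp_inl_inr]
  exact hγ

/-- An assignment setting at most one variable to true is zero or sets exactly one. -/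
theorem AMO.eq_false_or_exo {n : ℕ} {α : Fin n → Bool} (h : AMO n α) :
    α = (fun _ => false) ∨ EXO n α := by
  rcases Nat.le_one_iff_eq_zero_or_eq_one.1 h with h | h
  · left
    funext i
    simpa using Finset.filter_eq_empty_iff.1 (Finset.card_eq_zero.1 h) (Finset.mem_univ i)
  · exact Or.inr h

/-- Every p-encoding with n input variables is an encoding of AMO_n or
an encoding of EXO_n. -/
theorem p_encoding_encodes_amo_or_exo (n ℓ : ℕ) (φ : CNF (Var n ℓ))
    (hpe : IsPEncoding φ) :
    Encodes φ (AMO n) ∨ Encodes φ (EXO n) := by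
  by_cases h₀ : ∃ β : Fin ℓ → Bool, CnfSat (Sum.elim (fun _ => false) β) φ
  · refine Or.inl ⟨hpe.1, fun α => ⟨fun h => ?_, fun ⟨_, h⟩ => hpe.amo_of_cnfSat h⟩⟩
    rcases h.eq_false_or_exo with rfl | h
    · exact h₀
    · exact hpe.exists_cnfSat_of_exo h
  · refine Or.inr ⟨hpe.1, fun α => ⟨hpe.exists_cnfSat_of_exo, fun ⟨β, h⟩ => ?_⟩⟩
    rcases (hpe.amo_of_cnfSat h).eq_false_or_exo with rfl | h'
    · exact absurd ⟨β, h⟩ h₀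
    · exact h'
end

section
/- For every n ≥ 3, there is no 2-CNF encoding of EXO_n; that is, no 2-CNF formula φ(x,y) with input variables x_1,…,x_n and auxiliary variables y is an encoding of EXO_n. -/
/-- The pointwise majority of three assignments. -/
def majority {V : Type} (α β γ : V → Bool) : V → Bool :=
  fun v => (α v && β v) || (α v && γ v) || (β v && γ v)

/-- Satisfaction of a clause with at most two literals is preserved by majority. -/
theorem ClauseSat.majority {V : Type} {C : Clause V} (hC : C.card ≤ 2) {α β γ : V → Bool}
    (hα : ClauseSat α C) (hβ : ClauseSat β C) (hγ : ClauseSat γ C) :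
    ClauseSat (majority α β γ) C := by
  obtain ⟨a, ha, ha'⟩ := hα
  obtain ⟨b, hb, hb'⟩ := hβ
  obtain ⟨c, hc, hc'⟩ := hγ
  simp only [LitSat] at ha' hb' hc'
  have h : a = b ∨ a = c ∨ b = c := by
    by_contra! h
    exact absurd (Finset.two_lt_card_iff.2 ⟨a, b, c, ha, hb, hc, h⟩) (by omega)
  rcases h with rfl | rfl | rfl
  · refine ⟨a, ha, ?_⟩
    simp only [LitSat, _root_.majority, ha', hb']
    cases a.2 <;> simp
  · refine ⟨a, ha, ?_⟩
    simp only [LitSat, _root_.majority, ha', hc']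
    cases a.2 <;> simp
  · refine ⟨b, hb, ?_⟩
    simp only [LitSat, _root_.majority, hb', hc']
    cases b.2 <;> simp

/-- The models of a 2-CNF formula are closed under majority. -/
theorem CnfSat.majority {V : Type} {φ : CNF V} (h2 : Is2CNF φ) {α β γ : V → Bool}
    (hα : CnfSat α φ) (hβ : CnfSat β φ) (hγ : CnfSat γ φ) : CnfSat (majority α β γ) φ :=
  fun C hC => (hα C hC).majority (h2 C hC) (hβ C hC) (hγ C hC)

/-- A function with a 2-CNF encoding is closed under majority. -/
theorem Encodes.majority {n ℓ : ℕ} {φ : CNF (Var n ℓ)} {f : (Fin n → Bool) → Prop}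
    (h : Encodes φ f) (h2 : Is2CNF φ) {α β γ : Fin n → Bool} (hα : f α) (hβ : f β) (hγ : f γ) :
    f (majority α β γ) := by
  obtain ⟨a, ha⟩ := (h.2 α).1 hα
  obtain ⟨b, hb⟩ := (h.2 β).1 hβ
  obtain ⟨c, hc⟩ := (h.2 γ).1 hγ
  refine (h.2 _).2 ⟨_root_.majority a b c, ?_⟩
  convert ha.majority h2 hb hc using 1
  ext (i | j) <;> rfl

theorem exo_decide_eq {n : ℕ} (i : Fin n) : EXO n (fun j => decide (j = i)) := by
  simp [EXO, Finset.filter_eq']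

/-- For every n ≥ 3, no 2-CNF formula is an encoding of EXO_n. -/
theorem no_two_cnf_encoding_of_exo (n : ℕ) (hn : 3 ≤ n) (ℓ : ℕ)
    (φ : CNF (Var n ℓ)) (h2 : Is2CNF φ) :
    ¬ Encodes φ (EXO n) := by
  intro h
  have key := h.majority h2 (exo_decide_eq ⟨0, by omega⟩) (exo_decide_eq ⟨1, by omega⟩)
    (exo_decide_eq ⟨2, by omega⟩)
  obtain ⟨i, hi⟩ := Finset.card_pos.1 (key.symm ▸ Nat.one_pos)
  simp only [majority, Finset.mem_filter, Finset.mem_univ, true_and, Bool.or_eq_true,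
    Bool.and_eq_true, decide_eq_true_eq, Fin.ext_iff] at hi
  omega
end
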